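/- arXiv:1607.04742 — 3 statements merged into one kernel-verified Lean document; each statement's English description precedes it below -/
import Mathlib

section
/- The Gauss hypergeometric series satisfies ₂F₁(1/3, 1/3; 1; 1/9) = (1/4) · 3^{2/3} · Γ(1/3)³ / π², where Γ denotes the Gamma function. -/
open scoped Nat

/-- Pochhammer symbol (rising factorial) on the reals. -/
noncomputable def poch (a : ℝ) (n : ℕ) : ℝ := ∏ i ∈ Finset.range n, (a + i)

/-- Gauss hypergeometric series ₂F₁(a,b;c;x) as a real series. -/
noncomputable def twoFone (a b c x : ℝ) : ℝ :=
  ∑' n : ℕ, poch a n * poch b n / (poch c n * (n ! : ℝ)) * x ^ n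

open MeasureTheory Set

lemma beta_lint (α β : ℝ) (hα : 0 < α) (hβ : 0 < β) :
    ∫⁻ x in Ioo (0:ℝ) 1, ENNReal.ofReal (x ^ (α - 1) * (1 - x) ^ (β - 1)) =
      ENNReal.ofReal (ProbabilityTheory.beta α β) := by
  have hb := ProbabilityTheory.beta_pos hα hβ
  have h := ProbabilityTheory.lintegral_betaPDF_eq_one hα hβ
  rw [ProbabilityTheory.lintegral_betaPDF] at h
  have e : ∀ x : ℝ, ENNReal.ofReal (1 / ProbabilityTheory.beta α β * x ^ (α - 1) * (1 - x) ^ (β - 1))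
      = ENNReal.ofReal (1 / ProbabilityTheory.beta α β) *
        ENNReal.ofReal (x ^ (α - 1) * (1 - x) ^ (β - 1)) := by
    intro x
    rw [mul_assoc, ENNReal.ofReal_mul (by positivity)]
  simp_rw [e] at h
  rw [lintegral_const_mul _ (by fun_prop)] at h
  calc _ = ENNReal.ofReal (ProbabilityTheory.beta α β) *
        (ENNReal.ofReal (1 / ProbabilityTheory.beta α β) * ∫⁻ x in Ioo (0:ℝ) 1,
          ENNReal.ofReal (x ^ (α - 1) * (1 - x) ^ (β - 1))) := by
        rw [← mul_assoc, ← ENNReal.ofReal_mul hb.le, mul_one_div_cancel hb.ne']; simp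
    _ = _ := by rw [h, mul_one]

lemma poch_pos (a : ℝ) (ha : 0 < a) (n : ℕ) : 0 < poch a n := by
  unfold poch
  exact Finset.prod_pos fun i _ => by positivity

lemma poch_succ (a : ℝ) (n : ℕ) : poch a (n+1) = poch a n * (a + n) := by
  simp [poch, Finset.prod_range_succ]

lemma poch_one (n : ℕ) : poch 1 n = n ! := by
  induction n with
  | zero => simp [poch]
  | succ n ih => rw [poch_succ, ih, Nat.factorial_succ]; push_cast; ring

lemma poch_le (n : ℕ) : poch (1/3) n ≤ n ! := by
  rw [← poch_one]
  unfold poch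
  exact Finset.prod_le_prod (fun i _ => by positivity) (fun i _ => by norm_num)

lemma gamma_poch (a : ℝ) (ha : 0 < a) (n : ℕ) :
    Real.Gamma (n + a) = poch a n * Real.Gamma a := by
  induction n with
  | zero => simp [poch]
  | succ n ih =>
    rw [poch_succ, show ((n+1 : ℕ):ℝ) + a = (n + a) + 1 by push_cast; ring,
      Real.Gamma_add_one (by positivity), ih]; ring

lemma choose_poch (a : ℝ) (n : ℕ) : Ring.choose (a + n - 1) n = poch a n / n ! := by
  have h := Ring.factorial_nsmul_multichoose_eq_ascPochhammer a n
  rw [Polynomial.ascPochhammer_smeval_eq_eval] at h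
  have h2 : (ascPochhammer ℝ n).eval a = poch a n := by
    induction n with
    | zero => simp [poch]
    | succ n ih =>
      rw [ascPochhammer_succ_eval, poch_succ, ih]
      exact (Ring.factorial_nsmul_multichoose_eq_ascPochhammer a n).trans
        (Polynomial.ascPochhammer_smeval_eq_eval _ _)
  have h3 : Ring.choose (a + n - 1) n = Ring.multichoose a n := by
    unfold Ring.choose; congr 1; ring
  rw [h3, ← h2, ← h, nsmul_eq_mul]
  field_simp

lemma binom_hasSum (a x : ℝ) (hx0 : 0 < x) (hx : x < 1) :
    HasSum (fun n : ℕ => poch a n / n ! * x ^ n) ((1 - x) ^ (-a)) := by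
  have h := (Real.one_div_one_sub_rpow_hasFPowerSeriesOnBall_zero a).hasSum (y := x)
    (by simp [abs_of_pos hx0, hx, ← ofReal_norm])
  have h1 : (1 - x) ^ (-a) = 1 / (1 - (0 + x)) ^ a := by
    rw [zero_add, Real.rpow_neg (by linarith), one_div]
  rw [h1]
  have e : (fun n : ℕ => poch a n / n ! * x ^ n) = fun n =>
    (FormalMultilinearSeries.ofScalars ℝ (fun n => Ring.choose (a + (n:ℝ) - 1) n) n) fun _ => x := by
    funext n
    simp [FormalMultilinearSeries.ofScalars, choose_poch]
  rw [e]
  exact h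

lemma partA :
    ∫⁻ t in Ioo (0:ℝ) 1, ENNReal.ofReal (t ^ (-2/3 : ℝ) * (1 - t) ^ (-1/3 : ℝ) *
      (1 - t / 9) ^ (-1/3 : ℝ)) =
    ENNReal.ofReal (ProbabilityTheory.beta (1/3) (2/3) * twoFone (1/3) (1/3) 1 (1/9)) := by
  have hpos : ∀ n, 0 < poch (1/3) n := poch_pos _ (by norm_num)
  have hB : 0 < ProbabilityTheory.beta (1/3) (2/3) :=
    ProbabilityTheory.beta_pos (by norm_num) (by norm_num)
  have h1 : ∀ t ∈ Ioo (0:ℝ) 1, ENNReal.ofReal (t ^ (-2/3 : ℝ) * (1 - t) ^ (-1/3 : ℝ) *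
      (1 - t / 9) ^ (-1/3 : ℝ)) = ∑' n : ℕ, ENNReal.ofReal (poch (1/3) n / n ! * (1/9)^n) *
        ENNReal.ofReal (t ^ ((n + 1/3 : ℝ) - 1) * (1 - t) ^ ((2/3 : ℝ) - 1)) := by
    rintro t ⟨h0, h1⟩
    have hs := (binom_hasSum (1/3) (t/9) (by positivity) (by linarith)).mul_left
      (t ^ (-2/3 : ℝ) * (1 - t) ^ (-1/3 : ℝ))
    rw [show (-1/3 : ℝ) = -(1/3) by norm_num] at *
    have h1t : 0 < 1 - t := by linarith
    rw [← hs.tsum_eq, ENNReal.ofReal_tsum_of_nonneg _ hs.summable]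
    · congr 1
      ext n
      have := hpos n
      rw [← ENNReal.ofReal_mul (by positivity)]
      congr 1
      rw [show ((n + 1/3 : ℝ) - 1) = n + (-2/3) by ring, Real.rpow_add h0, Real.rpow_natCast,
        show (2/3 : ℝ) - 1 = -(1/3) by norm_num, div_pow, div_pow]
      ring
    · intro n
      have := hpos n
      positivity
  rw [setLIntegral_congr_fun measurableSet_Ioo h1, lintegral_tsum (fun n => by fun_prop)]
  have h2 : ∀ n : ℕ, ∫⁻ t in Ioo (0:ℝ) 1, ENNReal.ofReal (poch (1/3) n / n ! * (1/9)^n) *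
        ENNReal.ofReal (t ^ ((n + 1/3 : ℝ) - 1) * (1 - t) ^ ((2/3 : ℝ) - 1)) =
      ENNReal.ofReal (ProbabilityTheory.beta (1/3) (2/3) *
        (poch (1/3) n * poch (1/3) n / (poch 1 n * (n ! : ℝ)) * (1/9) ^ n)) := by
    intro n
    have := hpos n
    rw [lintegral_const_mul _ (by fun_prop), beta_lint _ _ (by positivity) (by norm_num),
      ← ENNReal.ofReal_mul (by positivity)]
    congr 1
    unfold ProbabilityTheory.beta
    rw [gamma_poch _ (by norm_num), poch_one,
      show (n + 1/3 + 2/3 : ℝ) = n + 1 by ring, Real.Gamma_nat_eq_factorial,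
      show (1/3 + 2/3 : ℝ) = 1 by norm_num, Real.Gamma_one]
    field_simp
  simp_rw [h2]
  rw [← ENNReal.ofReal_tsum_of_nonneg, tsum_mul_left]
  · rfl
  · intro n
    have := hpos n
    have := poch_pos 1 (by norm_num) n
    positivity
  · apply Summable.mul_left
    refine Summable.of_nonneg_of_le (fun n => ?_) (fun n => ?_)
      (summable_geometric_of_lt_one (r := (1/9 : ℝ)) (by norm_num) (by norm_num))
    · have := hpos n
      have := poch_pos 1 (by norm_num) n
      positivity
    · have h3 := poch_le n
      have := hpos n
      rw [poch_one]
      have hf : (0:ℝ) < n ! := by positivity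
      have : poch (1/3) n * poch (1/3) n / ((n ! : ℝ) * n !) ≤ 1 := by
        rw [div_le_one (by positivity)]
        gcongr
      exact mul_le_of_le_one_left (by positivity) this

lemma partG : ProbabilityTheory.beta (1/3) (1/6) * ((9:ℝ)^(1/3:ℝ) * (1/3) * (4:ℝ)^(-1/3:ℝ)) =
   ProbabilityTheory.beta (1/3) (2/3) * ((1/4) * (3:ℝ) ^ ((2:ℝ)/3) * Real.Gamma (1/3) ^ 3 / Real.pi ^ 2) := by
  have h1 := Real.Gamma_mul_Gamma_add_half (1/6)
  have h2 := Real.Gamma_mul_Gamma_one_sub (1/3)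
  rw [show (1/6 + 1/2 : ℝ) = 2/3 by norm_num, show (2 * (1/6) : ℝ) = 1/3 by norm_num,
    show (1 - 1/3 : ℝ) = 2/3 by norm_num] at h1
  rw [show (1 - 1/3 : ℝ) = 2/3 by norm_num, show Real.pi * (1/3) = Real.pi / 3 by ring,
    Real.sin_pi_div_three] at h2
  unfold ProbabilityTheory.beta
  rw [show (1/3 + 1/6 : ℝ) = 1/2 by norm_num, show (1/3 + 2/3 : ℝ) = 1 by norm_num, Real.Gamma_one,
    Real.Gamma_one_half_eq]
  have g1 : 0 < Real.Gamma (1/3) := Real.Gamma_pos_of_pos (by norm_num)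
  have g2 : 0 < Real.Gamma (2/3) := Real.Gamma_pos_of_pos (by norm_num)
  have g3 : 0 < √Real.pi := Real.sqrt_pos.2 Real.pi_pos
  have e9 : (9:ℝ)^(1/3:ℝ) = (3:ℝ)^((2:ℝ)/3) := by
    rw [show (9:ℝ) = 3^(2:ℝ) by norm_num, ← Real.rpow_mul (by norm_num)]; norm_num
  have e4 : (4:ℝ)^(-1/3:ℝ) * 2 ^ ((2:ℝ)/3) = 1 := by
    rw [show (4:ℝ) = 2^(2:ℝ) by norm_num, ← Real.rpow_mul (by norm_num), ← Real.rpow_add (by norm_num)]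
    norm_num
  rw [e9]
  generalize Real.Gamma (1/3) = A at *
  generalize Real.Gamma (2/3) = B at *
  generalize Real.Gamma (1/6) = C at *
  generalize (4:ℝ)^(-1/3:ℝ) = D at *
  generalize (2:ℝ)^((2:ℝ)/3) = E at *
  have hpi := Real.pi_pos
  have h3 : A^2 * B^2 * 3 = 4 * Real.pi^2 := by
    have : A * B * √3 = 2 * Real.pi := by rw [h2]; field_simp
    have h4 : (A*B*√3)^2 = (2*Real.pi)^2 := by rw [this]
    rw [mul_pow, Real.sq_sqrt (by norm_num)] at h4
    linarith
  have hC : C = A * E * √Real.pi / B := by field_simp; exact h1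
  rw [hC]
  field_simp
  linear_combination (-1) * h3 + 4*Real.pi^2*e4
lemma hda {f g : ℝ → ℝ} {f' g' x : ℝ} (h : HasDerivAt g g' x) (h1 : ∀ y, f y = g y)
    (h2 : f' = g') : HasDerivAt f f' x := by
  have : f = g := funext h1
  rw [this, h2]; exact h

lemma cov (s t : Set ℝ) (f f' F G : ℝ → ℝ) (hso : IsOpen s) (hsc : Convex ℝ s)
    (hd : ∀ x ∈ s, HasDerivAt f (f' x) x)
    (hsgn : (∀ x ∈ s, 0 < f' x) ∨ (∀ x ∈ s, f' x < 0))
    (hmap : ∀ x ∈ s, f x ∈ t)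
    (hsurj : ∀ y ∈ t, ∃ x₁ ∈ s, ∃ x₂ ∈ s, f x₁ ≤ y ∧ y ≤ f x₂)
    (hFG : ∀ x ∈ s, F x = |f' x| * G (f x)) :
    ∫⁻ x in s, ENNReal.ofReal (F x) = ∫⁻ y in t, ENNReal.ofReal (G y) := by
  have hc : ContinuousOn f s := fun x hx => (hd x hx).continuousAt.continuousWithinAt
  have him : f '' s = t := by
    apply Subset.antisymm
    · rintro _ ⟨x, hx, rfl⟩; exact hmap x hx
    · intro y hy
      obtain ⟨x₁, h₁, x₂, h₂, h3, h4⟩ := hsurj y hy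
      exact hsc.isPreconnected.intermediate_value h₁ h₂ hc ⟨h3, h4⟩
  have hinj : InjOn f s := by
    rcases hsgn with h | h
    · exact (strictMonoOn_of_deriv_pos hsc hc (fun x hx => by
        rw [hso.interior_eq] at hx
        rw [(hd x hx).deriv]; exact h x hx)).injOn
    · exact (strictAntiOn_of_deriv_neg hsc hc (fun x hx => by
        rw [hso.interior_eq] at hx
        rw [(hd x hx).deriv]; exact h x hx)).injOn
  rw [← him, lintegral_image_eq_lintegral_abs_deriv_mul hso.measurableSet
    (fun x hx => (hd x hx).hasDerivWithinAt) hinj]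
  refine setLIntegral_congr_fun hso.measurableSet fun x hx => ?_
  simp only [hFG x hx]
  rw [ENNReal.ofReal_mul (abs_nonneg _)]

lemma step1 :
    ∫⁻ t in Ioo (0:ℝ) 1, ENNReal.ofReal (t ^ (-2/3 : ℝ) * (1 - t) ^ (-1/3 : ℝ) *
      (9 - t) ^ (-1/3 : ℝ)) =
    ∫⁻ m in Ioi (0:ℝ), ENNReal.ofReal (m ^ (-1/3 : ℝ) / √((m+4)*(m+16))) := by
  apply cov (Ioo 0 1) (Ioi 0) (fun t => t + 9 / t - 10) (fun t => 1 - 9 / t^2) _ _ isOpen_Ioo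
    (convex_Ioo _ _)
  · rintro x ⟨h0, h1⟩
    have := (((hasDerivAt_id x).add ((hasDerivAt_inv h0.ne').const_mul 9)).sub_const 10)
    refine hda this (fun y => ?_) ?_
    · simp [div_eq_mul_inv]
    · ring
  · right
    rintro x ⟨h0, h1⟩
    rw [sub_neg, lt_div_iff₀ (by positivity)]
    nlinarith
  · rintro x ⟨h0, h1⟩
    have : x + 9 / x - 10 = (1-x)*(9-x)/x := by field_simp; ring
    simp only [mem_Ioi, this]
    exact div_pos (mul_pos (by linarith) (by linarith)) h0
  · intro y hy
    have hy : 0 < y := hy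
    refine ⟨9/(9+y), ⟨by positivity, by rw [div_lt_one (by positivity)]; linarith⟩,
      1/(1+y), ⟨by positivity, by rw [div_lt_one (by positivity)]; linarith⟩, ?_, ?_⟩
    · have : y - (9/(9+y) + 9/(9/(9+y)) - 10) = y / (9+y) := by field_simp; ring
      have : 0 < y / (9+y) := by positivity
      linarith
    · have : (1/(1+y) + 9/(1/(1+y)) - 10) - y = y*(7+8*y) / (1+y) := by field_simp; ring
      have : 0 < y*(7+8*y) / (1+y) := by positivity
      linarith
  · rintro x ⟨h0, h1⟩
    have e1 : x + 9 / x - 10 = (1-x)*(9-x)/x := by field_simp; ring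
    have p1 : 0 < 1 - x := by linarith
    have p2 : 0 < 9 - x := by linarith
    have p3 : 0 < 9 - x^2 := by nlinarith
    have e2 : (x + 9 / x - 10 + 4) * (x + 9/x-10+16) = ((9 - x^2)/x)^2 := by field_simp; ring
    have e3 : |1 - 9/x^2| = (9 - x^2)/x^2 := by
      rw [abs_of_neg]
      · field_simp; ring
      · rw [sub_neg, lt_div_iff₀ (by positivity)]
        nlinarith
    simp only [e2, e3]
    rw [Real.sqrt_sq (by positivity), e1, Real.div_rpow (by positivity) h0.le,
      Real.mul_rpow p1.le p2.le]
    have e4 : x ^ (-2/3:ℝ) = x^(-1/3:ℝ) * x^(-1/3:ℝ) := by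
      rw [← Real.rpow_add h0]; norm_num
    have e5 : x^(-1/3:ℝ) * x^(-1/3:ℝ) * x^(-1/3:ℝ) = x⁻¹ := by
      rw [← Real.rpow_add h0, ← Real.rpow_add h0, ← Real.rpow_neg_one]; norm_num
    have p4 : 0 < x^(-1/3:ℝ) := by positivity
    rw [e4]
    generalize x^(-1/3:ℝ) = a at *
    have : x = (a*a*a)⁻¹ := by rw [e5, inv_inv]
    have e6 : x * (a*a*a) = 1 := by rw [e5]; field_simp
    field_simp
    linear_combination e6

lemma step2 :
    ∫⁻ v in Ioi (0:ℝ), ENNReal.ofReal (3 * v / √((v^3+4)*(v^3+16))) =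
    ∫⁻ m in Ioi (0:ℝ), ENNReal.ofReal (m ^ (-1/3 : ℝ) / √((m+4)*(m+16))) := by
  apply cov (Ioi 0) (Ioi 0) (fun t => t^3) (fun t => 3 * t^2) _ _ isOpen_Ioi (convex_Ioi _)
  · intro x hx
    simpa using hasDerivAt_pow 3 x
  · left
    intro x hx
    have hx : 0 < x := hx
    positivity
  · intro x hx
    have hx : 0 < x := hx
    show 0 < x^3
    positivity
  · intro y hy
    have hy : 0 < y := hy
    have e : (y^(1/3:ℝ))^3 = y := by
      rw [← Real.rpow_natCast, ← Real.rpow_mul hy.le]; norm_num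
    refine ⟨y^(1/3:ℝ), by show 0 < y^(1/3:ℝ); positivity, y^(1/3:ℝ), by show 0 < y^(1/3:ℝ); positivity, e.le, e.ge⟩
  · intro x hx
    have hx : 0 < x := hx
    have e : (x^3)^(-1/3:ℝ) = x⁻¹ := by
      rw [← Real.rpow_natCast, ← Real.rpow_mul hx.le, ← Real.rpow_neg_one]; norm_num
    simp only [e]
    rw [abs_of_pos (by positivity)]
    field_simp

lemma step3a :
    ∫⁻ v in Ioi (2:ℝ), ENNReal.ofReal (6 / √((v^3+4)*(v^3+16))) =
    ∫⁻ v in Ioo (0:ℝ) 2, ENNReal.ofReal (3 * v / √((v^3+4)*(v^3+16))) := by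
  apply cov (Ioi 2) (Ioo 0 2) (fun t => 4 / t) (fun t => -4 / t^2) _ _ isOpen_Ioi (convex_Ioi _)
  · intro x hx
    have hx : 2 < x := hx
    have := (hasDerivAt_inv (x := x) (by linarith)).const_mul 4
    refine hda this (fun y => ?_) ?_
    · simp [div_eq_mul_inv]
    · ring
  · right
    intro x hx
    have hx : 2 < x := hx
    exact div_neg_of_neg_of_pos (by norm_num) (by positivity)
  · intro x hx
    have hx : 2 < x := hx
    exact ⟨by positivity, by rw [div_lt_iff₀ (by linarith)]; linarith⟩
  · rintro y ⟨h0, h2⟩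
    have h : 4/y ∈ Ioi (2:ℝ) := by
      show 2 < 4/y
      rw [lt_div_iff₀ h0]; linarith
    have e : 4/(4/y) = y := by field_simp
    exact ⟨4/y, h, 4/y, h, e.le, e.ge⟩
  · intro x hx
    have hx : 2 < x := hx
    have e : ((4/x)^3+4)*((4/x)^3+16) = (8/x^3)^2*((x^3+4)*(x^3+16)) := by
      field_simp; ring
    simp only [e]
    rw [Real.sqrt_mul (x := (8/x^3)^2) (by positivity), Real.sqrt_sq (by positivity),
      show -4/x^2 = -(4/x^2) by ring, abs_neg, abs_of_pos (by positivity)]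
    have : 0 < √((x^3+4)*(x^3+16)) := Real.sqrt_pos.2 (by positivity)
    field_simp
    norm_num

lemma step3 :
    ∫⁻ v in Ioi (0:ℝ), ENNReal.ofReal (3 * v / √((v^3+4)*(v^3+16))) =
    ∫⁻ v in Ioi (2:ℝ), ENNReal.ofReal (3 * (v + 2) / √((v^3+4)*(v^3+16))) := by
  have hu : Ioi (0:ℝ) = Ioc 0 2 ∪ Ioi 2 := (Ioc_union_Ioi_eq_Ioi (by norm_num)).symm
  rw [hu, lintegral_union measurableSet_Ioi
    (by rw [disjoint_left]; rintro x ⟨_, h⟩ h'; exact absurd h' (not_lt.2 h)),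
    setLIntegral_congr Ioo_ae_eq_Ioc.symm, ← step3a, ← lintegral_add_left (by fun_prop)]
  refine setLIntegral_congr_fun measurableSet_Ioi fun x hx => ?_
  have hx : 2 < x := hx
  rw [← ENNReal.ofReal_add (by positivity) (by positivity)]
  congr 1
  ring

lemma step4 :
    ∫⁻ v in Ioi (2:ℝ), ENNReal.ofReal (3 * (v + 2) / √((v^3+4)*(v^3+16))) =
    ∫⁻ r in Ioi (1:ℝ), ENNReal.ofReal (√3 / √(4*r^3-1)) := by
  apply cov (Ioi 2) (Ioi 1) (fun v => 1 + 3 * v / (v-2)^2) (fun v => -3*(v+2)/(v-2)^3) _ _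
    isOpen_Ioi (convex_Ioi _)
  · intro x hx
    have hx : 2 < x := hx
    have h2 : x - 2 ≠ 0 := by linarith
    have := (((hasDerivAt_id x).const_mul 3).div (((hasDerivAt_id x).sub_const 2).pow 2)
      (by simpa using h2)).const_add 1
    refine hda this (fun y => ?_) ?_
    · simp
    · simp
      field_simp
      ring
  · right
    intro x hx
    have hx : 2 < x := hx
    have : 0 < x - 2 := by linarith
    exact div_neg_of_neg_of_pos (by linarith) (by positivity)
  · intro x hx
    have hx : 2 < x := hx
    have : 0 < x - 2 := by linarith
    have : 0 < 3*x/(x-2)^2 := by positivity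
    rw [mem_Ioi]
    linarith
  · intro y hy
    have hy : 1 < y := hy
    obtain ⟨p, hp, rfl⟩ : ∃ p : ℝ, 0 < p ∧ y = 1 + 3*p := ⟨(y-1)/3, by linarith, by ring⟩
    refine ⟨4+2/p, ?_, 2+1/p, ?_, ?_, ?_⟩
    · show 2 < 4+2/p
      have : 0 < 2/p := by positivity
      linarith
    · show 2 < 2+1/p
      have : 0 < 1/p := by positivity
      linarith
    · have : (4+2/p)/(4+2/p-2)^2 ≤ p := by
        have e : 4+2/p-2 = 2*(p+1)/p := by field_simp; ring
        rw [e, div_le_iff₀ (by positivity)]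
        have : p*(2*(p+1)/p)^2 - (4+2/p) = 4 * p + 4 + 2/p := by field_simp; ring
        have : 0 < 2/p := by positivity
        linarith
      have e : 3*(4+2/p)/(4+2/p-2)^2 = 3*((4+2/p)/(4+2/p-2)^2) := by ring
      simp only [e]
      linarith
    · have e : 3*(2+1/p)/(2+1/p-2)^2 = 3*(2*p^2+p) := by
        rw [show 2+1/p-2 = 1/p by ring]; field_simp
      simp only [e]
      nlinarith
  · intro x hx
    have hx : 2 < x := hx
    have h2 : 0 < x - 2 := by linarith
    have e : 4*(1+3*x/(x-2)^2)^3-1 = 3*((x^3+4)*(x^3+16)/((x-2)^3)^2) := by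
      field_simp; ring
    simp only [e]
    rw [Real.sqrt_mul (x := 3) (by norm_num), Real.sqrt_div (by positivity), Real.sqrt_sq (by positivity),
      show -3*(x+2)/(x-2)^3 = -(3*(x+2)/(x-2)^3) by ring, abs_neg, abs_of_pos (by positivity)]
    have : 0 < √((x^3+4)*(x^3+16)) := Real.sqrt_pos.2 (by positivity)
    field_simp

lemma step5 :
    ∫⁻ r in Ioi (1:ℝ), ENNReal.ofReal (√3 / √(4*r^3-1)) =
    ∫⁻ r in Ioi (0:ℝ), ENNReal.ofReal (√3 / √(4*r^3+27)) := by
  apply cov (Ioi 1) (Ioi 0) (fun r => r - 1 / r^2) (fun r => 1 + 2 / r^3) _ _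
    isOpen_Ioi (convex_Ioi _)
  · intro x hx
    have hx : 1 < x := hx
    have h2 : x ≠ 0 := by linarith
    have := (hasDerivAt_id x).sub (((hasDerivAt_id x).pow 2).inv (by simpa using h2))
    refine hda this (fun y => ?_) ?_
    · simp
    · simp
      field_simp
      ring
  · left
    intro x hx
    have hx : 1 < x := hx
    positivity
  · intro x hx
    have hx : 1 < x := hx
    show 0 < x - 1/x^2
    have : x - 1/x^2 = (x-1)*(x^2+x+1)/x^2 := by field_simp; ring
    have : 0 < x - 1 := by linarith
    rw [‹x - 1/x^2 = _›]
    positivity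
  · intro y hy
    have hy : 0 < y := hy
    refine ⟨1+y/3, by show 1 < 1 + y/3; linarith, 1+y, by show 1 < 1+y; linarith, ?_, ?_⟩
    · have : y - (1+y/3 - 1/(1+y/3)^2) = (y/3)^2*(3+2*(y/3))/(1+y/3)^2 := by field_simp; ring
      have : 0 ≤ (y/3)^2*(3+2*(y/3))/(1+y/3)^2 := by positivity
      linarith
    · have : 1/(1+y)^2 ≤ 1 := by
        rw [div_le_one (by positivity)]; nlinarith
      linarith
  · intro x hx
    have hx : 1 < x := hx
    have hx3 : 1 < x^3 := one_lt_pow₀ hx (by norm_num)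
    have h4 : 0 < 4*x^3-1 := by linarith
    have e : 4*(x-1/x^2)^3+27 = (1+2/x^3)^2*(4*x^3-1) := by
      field_simp; ring
    simp only [e]
    rw [Real.sqrt_mul (by positivity), Real.sqrt_sq (by positivity), abs_of_pos (by positivity)]
    have : 0 < √(4*x^3-1) := Real.sqrt_pos.2 h4
    have : 0 < 1+2/x^3 := by positivity
    field_simp

lemma step6 :
    ∫⁻ s in Ioo (0:ℝ) 1, ENNReal.ofReal ((1/3) * (4:ℝ)^(-1/3:ℝ) *
      (s ^ ((1/3:ℝ)-1) * (1-s)^((1/6:ℝ)-1))) =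
    ∫⁻ r in Ioi (0:ℝ), ENNReal.ofReal (√3 / √(4*r^3+27)) := by
  have h4 : ((4:ℝ)^(-1/3:ℝ))^3 = 1/4 := by
    rw [← Real.rpow_natCast, ← Real.rpow_mul (by norm_num)]; norm_num
  have p4 : 0 < (4:ℝ)^(-1/3:ℝ) := by positivity
  generalize (4:ℝ)^(-1/3:ℝ) = k at *
  have cube : ∀ c : ℝ, 0 < c → (c^(1/3:ℝ))^3 = c := by
    intro c hc
    rw [← Real.rpow_natCast, ← Real.rpow_mul hc.le]; norm_num
  apply cov (Ioo 0 1) (Ioi 0) (fun s => 3 * k * (s/(1-s))^(1/3:ℝ))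
    (fun s => k * (s/(1-s))^(-2/3:ℝ) / (1-s)^2) _ _ isOpen_Ioo (convex_Ioo _ _)
  · rintro x ⟨h0, h1⟩
    have p : 0 < 1 - x := by linarith
    have hd : HasDerivAt (fun s : ℝ => s/(1-s)) (1/(1-x)^2) x := by
      have := (hasDerivAt_id x).div ((hasDerivAt_id x).const_sub 1) p.ne'
      refine hda this (fun y => ?_) ?_
      · simp
      · simp
    have := (hd.rpow_const (p := 1/3) (Or.inl (by positivity))).const_mul (3*k)
    refine hda this (fun y => rfl) ?_
    rw [show (1/3 - 1 : ℝ) = -2/3 by norm_num]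
    ring
  · left
    rintro x ⟨h0, h1⟩
    have p : 0 < 1 - x := by linarith
    positivity
  · rintro x ⟨h0, h1⟩
    have p : 0 < 1 - x := by linarith
    rw [mem_Ioi]
    positivity
  · intro y hy
    have hy : 0 < y := hy
    have m : (y/(3*k))^3/(1+(y/(3*k))^3) ∈ Ioo (0:ℝ) 1 :=
      ⟨by positivity, by rw [div_lt_one (by positivity)]; linarith⟩
    have e : 3*k*(((y/(3*k))^3/(1+(y/(3*k))^3)) / (1 - ((y/(3*k))^3/(1+(y/(3*k))^3))))^(1/3:ℝ) = y := by
      have pz : 0 < y/(3*k) := by positivity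
      have : y = 3*k*(y/(3*k)) := by field_simp
      conv_rhs => rw [this]
      generalize y/(3*k) = z at *
      have : z^3/(1+z^3)/(1-z^3/(1+z^3)) = z^3 := by
        have : 1 - z^3/(1+z^3) = 1/(1+z^3) := by field_simp; ring
        rw [this]; field_simp
      rw [this, ← Real.rpow_natCast, ← Real.rpow_mul pz.le]; norm_num
    exact ⟨_, m, _, m, e.le, e.ge⟩
  · rintro x ⟨h0, h1⟩
    have p : 0 < 1 - x := by linarith
    have e : 4*(3*k*(x/(1-x))^(1/3:ℝ))^3+27 = 3^2 * (3/(1-x)) := by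
      rw [mul_pow, mul_pow, h4, cube _ (by positivity)]
      field_simp; ring
    simp only [e]
    rw [Real.sqrt_mul (by positivity), Real.sqrt_sq (by norm_num), Real.sqrt_div (by norm_num),
      abs_of_pos (by positivity), Real.div_rpow h0.le p.le]
    have q3 : 0 < √(3:ℝ) := by positivity
    have e1 : (1-x)^((1/6:ℝ)-1) = √(1-x) / ((1-x)^2 * (1-x)^(-2/3:ℝ)) := by
      rw [Real.sqrt_eq_rpow, ← Real.rpow_natCast, ← Real.rpow_add p, ← Real.rpow_sub p]; norm_num
    rw [e1, show (1/3:ℝ)-1 = -2/3 by norm_num]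
    have : 0 < √(1-x) := Real.sqrt_pos.2 p
    field_simp

theorem stmt13 : twoFone (1/3) (1/3) (1) (1/9) = (1/4) * (3:ℝ) ^ ((2:ℝ)/3) * Real.Gamma (1/3) ^ 3 / Real.pi ^ 2 := by
  have hB : 0 < ProbabilityTheory.beta (1/3) (2/3) :=
    ProbabilityTheory.beta_pos (by norm_num) (by norm_num)
  have hA := partA
  have h9 : ∀ t ∈ Ioo (0:ℝ) 1, ENNReal.ofReal (t ^ (-2/3 : ℝ) * (1 - t) ^ (-1/3 : ℝ) *
      (1 - t / 9) ^ (-1/3 : ℝ)) = ENNReal.ofReal ((9:ℝ)^(1/3:ℝ)) *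
      ENNReal.ofReal (t ^ (-2/3 : ℝ) * (1 - t) ^ (-1/3 : ℝ) * (9 - t) ^ (-1/3 : ℝ)) := by
    rintro t ⟨h0, h1⟩
    rw [← ENNReal.ofReal_mul (by positivity), show 1 - t/9 = (9-t)/9 by ring,
      Real.div_rpow (by linarith) (by norm_num), show (-1/3:ℝ) = -(1/3) by norm_num,
      Real.rpow_neg (by norm_num : (0:ℝ) ≤ 9)]
    congr 1
    field_simp
  rw [setLIntegral_congr_fun measurableSet_Ioo h9, lintegral_const_mul _ (by fun_prop), step1,
    ← step2, step3, step4, step5, ← step6] at hA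
  have h6 : ∀ s : ℝ, ENNReal.ofReal ((1/3) * (4:ℝ)^(-1/3:ℝ) *
      (s ^ ((1/3:ℝ)-1) * (1-s)^((1/6:ℝ)-1))) = ENNReal.ofReal ((1/3) * (4:ℝ)^(-1/3:ℝ)) *
      ENNReal.ofReal (s ^ ((1/3:ℝ)-1) * (1-s)^((1/6:ℝ)-1)) := fun s =>
    ENNReal.ofReal_mul (by positivity)
  simp_rw [h6] at hA
  have hC : 0 < ProbabilityTheory.beta (1/3) (1/6) :=
    ProbabilityTheory.beta_pos (by norm_num) (by norm_num)
  rw [lintegral_const_mul _ (by fun_prop), beta_lint _ _ (by norm_num) (by norm_num),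
    ← ENNReal.ofReal_mul (by positivity), ← ENNReal.ofReal_mul (by positivity)] at hA
  have hT : 0 ≤ twoFone (1/3) (1/3) 1 (1/9) := by
    unfold twoFone
    refine tsum_nonneg fun n => ?_
    have := poch_pos (1/3) (by norm_num) n
    have := poch_pos 1 (by norm_num) n
    positivity
  rw [ENNReal.ofReal_eq_ofReal_iff (by positivity) (by positivity)] at hA
  have hG := partG
  apply mul_left_cancel₀ hB.ne'
  rw [← hA, ← hG]
  ring
end

section
/- For all complex a with Re(a) ≥ 0, Appell's series satisfies F₁(1/2; 2a, 3a−1/2; 3a+1/2; 1/5, −4/5) = √(3/5) · Γ(a+1/6) Γ(a+5/6) / (Γ(a+1/3) Γ(a+2/3)). -/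
open scoped Nat

/-- Pochhammer symbol (rising factorial) on the complex numbers. -/
noncomputable def cpoch (a : ℂ) (n : ℕ) : ℂ := ∏ i ∈ Finset.range n, (a + i)

/-- Appell's hypergeometric series F₁(α; β₁, β₂; γ; x, y) as a complex double series. -/
noncomputable def appellF1 (α β₁ β₂ γ x y : ℂ) : ℂ :=
  ∑' p : ℕ × ℕ,
    cpoch α (p.1 + p.2) * cpoch β₁ p.1 * cpoch β₂ p.2 /
      (cpoch γ (p.1 + p.2) * (p.1 ! : ℂ) * (p.2 ! : ℂ)) * x ^ p.1 * y ^ p.2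

open Filter Topology MeasureTheory

lemma cpoch_eq_asc (b : ℂ) (n : ℕ) : cpoch b n = (ascPochhammer ℂ n).eval b := by
  unfold cpoch
  induction n with
  | zero => simp
  | succ n ih => rw [Finset.prod_range_succ, ih, ascPochhammer_succ_eval]

lemma hasSum_binom (b z : ℂ) (hz : ‖z‖ < 1) :
    HasSum (fun n : ℕ => cpoch b n / (n ! : ℂ) * z ^ n) ((1 - z) ^ (-b)) := by
  have h := (Complex.one_div_one_sub_cpow_hasFPowerSeriesOnBall_zero b).hasSum (y := z)
    (by
      rw [← ENNReal.ofReal_one, Metric.eball_ofReal]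
      simpa using hz)
  simp only [zero_add, FormalMultilinearSeries.ofScalars_apply_eq, smul_eq_mul] at h
  rw [Complex.cpow_neg, ← one_div]
  convert h using 2 with n
  congr 1
  have h2 := Ring.factorial_nsmul_multichoose_eq_ascPochhammer b n
  rw [Polynomial.ascPochhammer_smeval_eq_eval, ← cpoch_eq_asc] at h2
  have h3 : (n ! : ℂ) ≠ 0 := by exact_mod_cast n.factorial_ne_zero
  rw [← h2, Ring.multichoose_eq, nsmul_eq_mul, mul_div_cancel_left₀ _ h3]

lemma summable_binom (b z : ℂ) (hz : ‖z‖ < 1) :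
    Summable (fun n : ℕ => ‖cpoch b n / (n ! : ℂ) * z ^ n‖) :=
  (hasSum_binom b z hz).summable.norm

lemma Gamma_cpoch (s : ℂ) (hs : 0 < s.re) (k : ℕ) :
    Complex.Gamma (s + k) = cpoch s k * Complex.Gamma s := by
  unfold cpoch
  induction k with
  | zero => simp
  | succ n ih =>
    have : s + n ≠ 0 := by
      intro h
      have := congrArg Complex.re h
      simp at this
      have : (0:ℝ) ≤ n := n.cast_nonneg
      linarith
    rw [Finset.prod_range_succ]
    push_cast
    rw [← add_assoc, Complex.Gamma_add_one _ this, ih]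
    ring

lemma cpoch_ne_zero (s : ℂ) (hs : 0 < s.re) (k : ℕ) : cpoch s k ≠ 0 := by
  unfold cpoch
  rw [Finset.prod_ne_zero_iff]
  intro i _ h
  have := congrArg Complex.re h
  simp at this
  have : (0:ℝ) ≤ i := i.cast_nonneg
  linarith

lemma beta_cpoch (α δ : ℂ) (hα : 0 < α.re) (hδ : 0 < δ.re) (k : ℕ) :
    Complex.betaIntegral (α + k) δ = cpoch α k / cpoch (α + δ) k * Complex.betaIntegral α δ := by
  have h1 : 0 < (α + k).re := by
    have : (0:ℝ) ≤ k := k.cast_nonneg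
    simp; linarith
  have h2 : 0 < (α + δ).re := by simp; linarith
  rw [Complex.betaIntegral_eq_Gamma_mul_div _ _ h1 hδ, Complex.betaIntegral_eq_Gamma_mul_div _ _ hα hδ,
    Gamma_cpoch α hα, show α + k + δ = α + δ + k by ring, Gamma_cpoch _ h2]
  have := cpoch_ne_zero _ h2 k
  have := Complex.Gamma_ne_zero_of_re_pos h2
  field_simp

lemma appell_integral (α β₁ β₂ δ x y : ℂ) (hα : 0 < α.re) (hδ : 0 < δ.re)
    (hx : ‖x‖ < 1) (hy : ‖y‖ < 1) :
    appellF1 α β₁ β₂ (α + δ) x y * Complex.betaIntegral α δ =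
      ∫ t : ℝ in 0..1, ((1 - x * t) ^ (-β₁) * (1 - y * t) ^ (-β₂)) *
        ((t : ℂ) ^ (α - 1) * (1 - (t : ℂ)) ^ (δ - 1)) := by
  set c : ℕ × ℕ → ℂ := fun p => (cpoch β₁ p.1 / (p.1 ! : ℂ) * x ^ p.1) *
    (cpoch β₂ p.2 / (p.2 ! : ℂ) * y ^ p.2) with hc
  have hcs : Summable (fun p => ‖c p‖) := by
    simp only [hc, norm_mul (_ * _) (_ * _)]
    exact (summable_binom β₁ x hx).mul_of_nonneg (summable_binom β₂ y hy)
      (fun _ => norm_nonneg _) (fun _ => norm_nonneg _)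
  set g : ℝ → ℂ := fun t => (t : ℂ) ^ (α - 1) * (1 - (t : ℂ)) ^ (δ - 1) with hg
  have hgi : IntervalIntegrable g volume 0 1 := Complex.betaIntegral_convergent hα hδ
  have key := intervalIntegral.hasSum_integral_of_dominated_convergence (μ := volume) (a := 0) (b := 1)
    (F := fun (p : ℕ × ℕ) (t : ℝ) => c p * (t : ℂ) ^ (p.1 + p.2) * g t)
    (f := fun t : ℝ => ((1 - x * t) ^ (-β₁) * (1 - y * t) ^ (-β₂)) * g t)
    (bound := fun p t => ‖c p‖ * ‖g t‖) ?_ ?_ ?_ ?_ ?_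
  · rw [← key.tsum_eq, appellF1, ← tsum_mul_right]
    congr 1
    ext p
    have : ∫ t : ℝ in 0..1, c p * (t : ℂ) ^ (p.1 + p.2) * g t =
        c p * Complex.betaIntegral (α + (p.1 + p.2 : ℕ)) δ := by
      rw [Complex.betaIntegral, ← intervalIntegral.integral_const_mul]
      rw [intervalIntegral.integral_of_le zero_le_one, intervalIntegral.integral_of_le zero_le_one]
      refine setIntegral_congr_fun measurableSet_Ioc fun t ht => ?_
      have h0 : (t : ℂ) ≠ 0 := by exact_mod_cast ht.1.ne'
      simp only [hg]
      rw [show α + ((p.1 + p.2 : ℕ) : ℂ) - 1 = (α - 1) + ((p.1 + p.2 : ℕ) : ℂ) by ring,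
        Complex.cpow_add _ _ h0, Complex.cpow_natCast]
      ring
    rw [this, beta_cpoch α δ hα hδ]
    have h2 : 0 < (α + δ).re := by simp; linarith
    have := cpoch_ne_zero _ h2 (p.1 + p.2)
    simp only [hc]
    field_simp
  · intro p
    refine AEStronglyMeasurable.mul ?_ ?_
    · exact (by fun_prop : Continuous fun t : ℝ => c p * (t : ℂ) ^ (p.1 + p.2)).aestronglyMeasurable
    · exact hgi.def'.aestronglyMeasurable
  · intro p
    refine ae_of_all _ fun t ht => ?_
    rw [Set.uIoc_of_le zero_le_one] at ht
    rw [norm_mul, norm_mul]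
    gcongr
    rw [norm_pow, Complex.norm_real, Real.norm_of_nonneg ht.1.le]
    exact mul_le_of_le_one_right (norm_nonneg _) (pow_le_one₀ ht.1.le ht.2)
  · exact ae_of_all _ fun t ht => hcs.mul_right _
  · simp only [tsum_mul_right]
    exact hgi.norm.const_mul _
  · refine ae_of_all _ fun t ht => ?_
    rw [Set.uIoc_of_le zero_le_one] at ht
    refine HasSum.mul_right _ ?_
    have ht1 : ‖(t : ℂ)‖ ≤ 1 := by
      rw [Complex.norm_real, Real.norm_of_nonneg ht.1.le]; exact ht.2
    have hx' : ‖x * t‖ < 1 := by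
      rw [norm_mul]; exact (mul_le_of_le_one_right (norm_nonneg _) ht1).trans_lt hx
    have hy' : ‖y * t‖ < 1 := by
      rw [norm_mul]; exact (mul_le_of_le_one_right (norm_nonneg _) ht1).trans_lt hy
    have hs1 := summable_binom β₁ _ hx'
    have hs2 := summable_binom β₂ _ hy'
    have hs := summable_mul_of_summable_norm hs1 hs2
    have := HasSum.mul (hasSum_binom β₁ _ hx') (hasSum_binom β₂ _ hy') hs
    refine this.congr_fun ?_
    intro p
    simp only [hc, mul_pow, pow_add]
    ring

lemma aux_alg (M r q f g T N0 N1 N2 N3 N4 N5 P0 P1 P2 P3 P4 P5 : ℂ) (hT : T ≠ 0)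
    (h0 : P0 ≠ 0) (h1 : P1 ≠ 0) (h2 : P2 ≠ 0) (h3 : P3 ≠ 0) (h4 : P4 ≠ 0) (h5 : P5 ≠ 0)
    (h : N3 * N4 * N5 = N0 * N1 * N2 * q) :
    M * (r * q) * f / (T * (P3 * P4 * P5)) * (N0 * g / P0 * (N1 * g / P1) * (N2 * g / P2)) =
    r * (M * f / (T * (P0 * P1 * P2)) * (N3 * g / P3 * (N4 * g / P4) * (N5 * g / P5))) := by
  have e1 : M * (r * q) * f / (T * (P3 * P4 * P5)) * (N0 * g / P0 * (N1 * g / P1) * (N2 * g / P2)) =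
      (N0 * N1 * N2 * q) * (M * r * f * g ^ 3 / (T * (P3 * P4 * P5) * (P0 * P1 * P2))) := by
    field_simp
  have e2 : r * (M * f / (T * (P0 * P1 * P2)) * (N3 * g / P3 * (N4 * g / P4) * (N5 * g / P5))) =
      (N3 * N4 * N5) * (M * r * f * g ^ 3 / (T * (P3 * P4 * P5) * (P0 * P1 * P2))) := by
    field_simp
  rw [e1, e2, h]

lemma prod_three (s : ℂ) (n : ℕ) :
    ∏ j ∈ Finset.range (3 * n + 2 + 1), (3 * s + j) =
      3 ^ (3 * n + 3) * ((∏ j ∈ Finset.range (n + 1), (s + j)) *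
        (∏ j ∈ Finset.range (n + 1), (s + 1/3 + j)) * (∏ j ∈ Finset.range (n + 1), (s + 2/3 + j))) := by
  induction n with
  | zero => simp [Finset.prod_range_succ]; ring
  | succ n ih =>
    rw [show 3 * (n + 1) + 2 + 1 = (3 * n + 2 + 1) + 1 + 1 + 1 by ring, Finset.prod_range_succ,
      Finset.prod_range_succ, Finset.prod_range_succ, ih, Finset.prod_range_succ _ (n+1),
      Finset.prod_range_succ _ (n+1), Finset.prod_range_succ _ (n+1)]
    push_cast
    ring

lemma Gamma_triple (a : ℂ) (ha : 0 < a.re) :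
    Complex.Gamma (3 * a + 1/2) * (Complex.Gamma a * Complex.Gamma (a + 1/3) * Complex.Gamma (a + 2/3)) =
      (Real.sqrt 3 : ℂ) * (Complex.Gamma (3 * a) *
        (Complex.Gamma (a + 1/6) * Complex.Gamma (a + 1/2) * Complex.Gamma (a + 5/6))) := by
  have hN : Tendsto (fun n : ℕ => 3 * n + 2) atTop atTop :=
    tendsto_atTop_mono (fun n => by simp only [id]; omega) tendsto_id
  have T := Complex.GammaSeq_tendsto_Gamma
  have hL := ((T (3 * a + 1/2)).comp hN).mul (((T a).mul (T (a + 1/3))).mul (T (a + 2/3)))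
  have hR := ((T (3 * a)).comp hN).mul (((T (a + 1/6)).mul (T (a + 1/2))).mul (T (a + 5/6)))
  have hr : Tendsto (fun n : ℕ => ((Real.sqrt (3 + 2 * (n : ℝ)⁻¹) : ℝ) : ℂ)) atTop (𝓝 (Real.sqrt 3 : ℂ)) := by
    refine (Complex.continuous_ofReal.tendsto _).comp ?_
    refine (Real.continuous_sqrt.tendsto _).comp ?_
    have := (tendsto_inv_atTop_nhds_zero_nat (𝕜 := ℝ)).const_mul 2 |>.const_add 3
    simpa using this
  refine tendsto_nhds_unique (hL.congr' ?_) (hr.mul hR)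
  filter_upwards [eventually_gt_atTop 0] with n hn
  simp only [Function.comp_apply, Complex.GammaSeq]
  have e1 := prod_three a n
  have e2 := prod_three (a + 1/6) n
  rw [show 3 * (a + 1/6) = 3 * a + 1/2 by ring, show a + 1/6 + 1/3 = a + 1/2 by ring,
    show a + 1/6 + 2/3 = a + 5/6 by ring] at e2
  rw [e1, e2]
  have nz : ∀ r : ℝ, 0 ≤ r → ∏ j ∈ Finset.range (n + 1), (a + r + j) ≠ 0 := by
    intro r hr
    exact cpoch_ne_zero (a + r) (by simp; linarith) (n + 1)
  have z0 := nz 0 le_rfl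
  have z1 := nz (1/3) (by norm_num)
  have z2 := nz (2/3) (by norm_num)
  have z3 := nz (1/6) (by norm_num)
  have z4 := nz (1/2) (by norm_num)
  have z5 := nz (5/6) (by norm_num)
  push_cast at z0 z1 z2 z3 z4 z5
  rw [add_zero] at z0
  set P0 := ∏ j ∈ Finset.range (n + 1), (a + j)
  set P1 := ∏ j ∈ Finset.range (n + 1), (a + 1/3 + j)
  set P2 := ∏ j ∈ Finset.range (n + 1), (a + 2/3 + j)
  set P3 := ∏ j ∈ Finset.range (n + 1), (a + 1/6 + j)
  set P4 := ∏ j ∈ Finset.range (n + 1), (a + 1/2 + j)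
  set P5 := ∏ j ∈ Finset.range (n + 1), (a + 5/6 + j)
  have hn0 : (n : ℂ) ≠ 0 := by exact_mod_cast hn.ne'
  have hM0 : ((3 * n + 2 : ℕ) : ℂ) ≠ 0 := Nat.cast_ne_zero.mpr (by omega)
  have half : ∀ m : ℕ, (m : ℂ) ^ (1/2 : ℂ) = (Real.sqrt m : ℂ) := by
    intro m
    rw [Real.sqrt_eq_rpow, Complex.ofReal_cpow m.cast_nonneg]
    simp
  have hs : (Real.sqrt ((3 * n + 2 : ℕ) : ℝ) : ℂ) = (Real.sqrt (3 + 2 * (n : ℝ)⁻¹) : ℂ) * (Real.sqrt n : ℂ) := by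
    rw [← Complex.ofReal_mul, ← Real.sqrt_mul (by positivity)]
    congr 2
    have : (n : ℝ) ≠ 0 := by exact_mod_cast hn.ne'
    push_cast
    field_simp
  have p1 : ((3 * n + 2 : ℕ) : ℂ) ^ (3 * a + 1/2) =
      ((3 * n + 2 : ℕ) : ℂ) ^ (3 * a) * ((Real.sqrt (3 + 2 * (n : ℝ)⁻¹) : ℂ) * (Real.sqrt n : ℂ)) := by
    rw [Complex.cpow_add _ _ hM0, half, hs]
  have p2 : (n : ℂ) ^ (a + 1/6) * (n : ℂ) ^ (a + 1/2) * (n : ℂ) ^ (a + 5/6) =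
      (n : ℂ) ^ a * (n : ℂ) ^ (a + 1/3) * (n : ℂ) ^ (a + 2/3) * (Real.sqrt n : ℂ) := by
    rw [← half]
    simp only [← Complex.cpow_add _ _ hn0]
    congr 1
    ring
  rw [p1]
  exact aux_alg _ _ _ _ _ _ _ _ _ _ _ _ _ _ _ _ _ _ (pow_ne_zero _ three_ne_zero) z0 z1 z2 z3 z4 z5 p2

lemma aux_alg2 (F G0 G1 G2 G3 G4 G5 G6 G7 G8 s3 s5 : ℂ) (_g0 : G0 ≠ 0) (g1 : G1 ≠ 0) (g2 : G2 ≠ 0)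
    (_g3 : G3 ≠ 0) (g4 : G4 ≠ 0) (_g5 : G5 ≠ 0) (g6 : G6 ≠ 0) (g7 : G7 ≠ 0) (g8 : G8 ≠ 0) (h5 : s5 ≠ 0)
    (h2 : G0 * G7 / G4 = s5 * (F * (G7 * G6 / G8)))
    (h4 : G8 * (G0 * G1 * G2) = s3 * (G6 * (G3 * G4 * G5))) :
    F = s3 / s5 * G3 * G5 / (G1 * G2) := by
  have h2' : G0 * G8 = s5 * F * G6 * G4 := by
    field_simp at h2
    linear_combination h2
  rw [show s3 / s5 * G3 * G5 / (G1 * G2) = (s3 * G3 * G5) / (s5 * G1 * G2) by field_simp,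
    eq_div_iff (by simp [*])]
  have h6 : G6 * G4 ≠ 0 := by simp [*]
  apply mul_right_cancel₀ h6
  linear_combination h4 - h2' * G1 * G2

noncomputable def Wf (t : ℝ) : ℝ := (1 - t) ^ 3 / ((1 - t/5) ^ 2 * (1 + 4*t/5) ^ 3)
noncomputable def Wq (t : ℝ) : ℝ := (125 - 25 * t + 8 * t ^ 2) / 25
noncomputable def Wd (t : ℝ) : ℝ := -((1 - t) ^ 2 * Wq t / ((1 - t/5) ^ 3 * (1 + 4*t/5) ^ 4))

lemma Wq_pos (t : ℝ) : 0 < Wq t := by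
  unfold Wq
  have : 0 < 125 - 25 * t + 8 * t ^ 2 := by nlinarith [sq_nonneg (t - 25/16)]
  positivity

lemma Wf_deriv (t : ℝ) (ht : t ∈ Set.Icc (0:ℝ) 1) : HasDerivAt Wf (Wd t) t := by
  obtain ⟨h0, h1⟩ := ht
  have hB : (1 - t/5) ≠ 0 := by linarith
  have hC : (1 + 4*t/5) ≠ 0 := by linarith
  have d1 : HasDerivAt (fun t : ℝ => (1 - t) ^ 3) (3 * (1 - t) ^ 2 * (-1)) t := by
    simpa using ((hasDerivAt_id t).const_sub 1).fun_pow 3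
  have dB : HasDerivAt (fun t : ℝ => (1 - t/5) ^ 2) (2 * (1 - t/5) * (-(1/5))) t := by
    simpa using (((hasDerivAt_id t).div_const 5).const_sub 1).fun_pow 2
  have dC : HasDerivAt (fun t : ℝ => (1 + 4*t/5) ^ 3) (3 * (1 + 4*t/5) ^ 2 * (4/5)) t := by
    simpa using ((((hasDerivAt_id t).const_mul 4).div_const 5).const_add 1).fun_pow 3
  have := d1.fun_div (dB.fun_mul dC) (by simp [hB, hC])
  refine HasDerivAt.congr_deriv (f := Wf) this ?_
  symm
  unfold Wd Wq
  rw [neg_eq_iff_eq_neg, ← neg_div, div_eq_div_iff (by positivity) (by positivity)]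
  ring

lemma Wf_anti : StrictAntiOn Wf (Set.Icc 0 1) := by
  refine strictAntiOn_of_deriv_neg (convex_Icc 0 1)
    (fun t ht => (Wf_deriv t ht).continuousAt.continuousWithinAt) ?_
  intro t ht
  rw [interior_Icc] at ht
  rw [(Wf_deriv t ⟨ht.1.le, ht.2.le⟩).deriv]
  unfold Wd
  have := Wq_pos t
  have : 0 < 1 - t := by linarith [ht.2]
  have : 0 < 1 - t/5 := by linarith [ht.2]
  have : 0 < 1 + 4*t/5 := by linarith [ht.1]
  rw [neg_lt_zero]
  positivity

lemma Wf_image : Wf '' Set.Ioo 0 1 = Set.Ioo 0 1 := by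
  have w0 : Wf 0 = 1 := by simp [Wf]
  have w1 : Wf 1 = 0 := by simp [Wf]
  apply Set.Subset.antisymm
  · rintro _ ⟨t, ht, rfl⟩
    have ht' : t ∈ Set.Icc (0:ℝ) 1 := ⟨ht.1.le, ht.2.le⟩
    constructor
    · rw [← w1]; exact Wf_anti ht' (by simp) ht.2
    · rw [← w0]; exact Wf_anti (by simp) ht' ht.1
  · have := intermediate_value_Ioo' (f := Wf) (zero_le_one (α := ℝ))
      (fun t ht => (Wf_deriv t ht).continuousAt.continuousWithinAt)
    rwa [w0, w1] at this

lemma cpow_neg_half (r : ℝ) (hr : 0 < r) : (r : ℂ) ^ ((1:ℂ)/2 - 1) = ((Real.sqrt r : ℝ) : ℂ)⁻¹ := by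
  rw [Real.sqrt_eq_rpow, ← Complex.ofReal_inv, ← Real.rpow_neg hr.le, Complex.ofReal_cpow hr.le]
  congr 1
  push_cast
  norm_num

lemma cpow_half (r : ℝ) (hr : 0 < r) : (r : ℂ) ^ ((1:ℂ)/2) = ((Real.sqrt r : ℝ) : ℂ) := by
  rw [Real.sqrt_eq_rpow, Complex.ofReal_cpow hr.le]
  norm_num

lemma cov_point (a : ℂ) (t : ℝ) (ht : t ∈ Set.Ioo (0:ℝ) 1) :
    |Wd t| • (((Wf t : ℝ) : ℂ) ^ (a - 1) * (1 - ((Wf t : ℝ) : ℂ)) ^ ((1:ℂ)/2 - 1)) =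
      (Real.sqrt 5 : ℂ) * (((1 - (1/5) * (t:ℂ)) ^ (-(2 * a)) * (1 - (-4/5) * (t:ℂ)) ^ (-(3 * a - 1/2))) *
        ((t : ℂ) ^ ((1:ℂ)/2 - 1) * (1 - (t : ℂ)) ^ (3 * a - 1))) := by
  have hq := Wq_pos t
  have hA : 0 < 1 - t := by linarith [ht.2]
  have hB : 0 < 1 - t/5 := by linarith [ht.2]
  have hC : 0 < 1 + 4*t/5 := by linarith [ht.1]
  have h1W : 1 - Wf t = t * Wq t ^ 2 / (5 * ((1 - t/5) ^ 2 * (1 + 4*t/5) ^ 3)) := by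
    unfold Wf Wq
    have hD : (1 - t/5) ^ 2 * (1 + 4*t/5) ^ 3 ≠ 0 := by positivity
    rw [one_sub_div hD, div_eq_div_iff hD (by positivity)]
    ring
  have hWd : |Wd t| = (1 - t) ^ 2 * Wq t / ((1 - t/5) ^ 3 * (1 + 4*t/5) ^ 4) := by
    unfold Wd
    rw [abs_neg, abs_of_pos (by positivity)]
  have hW : Wf t = (1 - t) ^ 3 / ((1 - t/5) ^ 2 * (1 + 4*t/5) ^ 3) := rfl
  have eA : (1 - (t:ℂ)) = ((1 - t : ℝ) : ℂ) := by push_cast; ring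
  have eB : (1 - (1/5) * (t:ℂ)) = ((1 - t/5 : ℝ) : ℂ) := by push_cast; ring
  have eC : (1 - (-4/5) * (t:ℂ)) = ((1 + 4*t/5 : ℝ) : ℂ) := by push_cast; ring
  have eW : (1 - ((Wf t : ℝ) : ℂ)) = ((1 - Wf t : ℝ) : ℂ) := by push_cast; ring
  rw [eA, eB, eC, eW, h1W, hW, hWd]
  have ht0 := ht.1
  generalize hQ : Wq t = q at *
  generalize hA' : 1 - t = A at *
  generalize hB' : 1 - t/5 = B at *
  generalize hC' : 1 + 4*t/5 = C at *
  clear eA eB eC eW hW hWd h1W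
  rw [cpow_neg_half _ (by positivity), cpow_neg_half _ ht0]
  have hs : Real.sqrt (t * q ^ 2 / (5 * (B ^ 2 * C ^ 3))) =
      Real.sqrt t * q / (Real.sqrt 5 * (B * C * Real.sqrt C)) := by
    rw [Real.sqrt_eq_iff_eq_sq (by positivity) (by positivity), div_pow, mul_pow, mul_pow, mul_pow,
      mul_pow, Real.sq_sqrt ht0.le, Real.sq_sqrt (by norm_num), Real.sq_sqrt hC.le]
    ring
  have cA : (A : ℂ) ≠ 0 := by exact_mod_cast hA.ne'
  have cB : (B : ℂ) ≠ 0 := by exact_mod_cast hB.ne'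
  have cC : (C : ℂ) ≠ 0 := by exact_mod_cast hC.ne'
  have cq : (q : ℂ) ≠ 0 := by exact_mod_cast hq.ne'
  have hW0 : 0 < A ^ 3 / (B ^ 2 * C ^ 3) := by positivity
  have cW : ((A ^ 3 / (B ^ 2 * C ^ 3) : ℝ) : ℂ) ≠ 0 := by exact_mod_cast hW0.ne'
  have hWa : ((A ^ 3 / (B ^ 2 * C ^ 3) : ℝ) : ℂ) ^ a =
      (A : ℂ) ^ (3 * a) * (B : ℂ) ^ (-(2 * a)) * (C : ℂ) ^ (-(3 * a)) := by
    rw [Complex.cpow_def_of_ne_zero cW, Complex.cpow_def_of_ne_zero cA, Complex.cpow_def_of_ne_zero cB,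
      Complex.cpow_def_of_ne_zero cC, ← Complex.exp_add, ← Complex.exp_add,
      ← Complex.ofReal_log hW0.le, ← Complex.ofReal_log hA.le, ← Complex.ofReal_log hB.le,
      ← Complex.ofReal_log hC.le, Real.log_div (by positivity) (by positivity),
      Real.log_mul (by positivity) (by positivity), Real.log_pow, Real.log_pow, Real.log_pow]
    congr 1
    push_cast
    ring
  rw [hs, Complex.cpow_sub _ _ cW, Complex.cpow_one, hWa, Complex.cpow_sub _ _ cA, Complex.cpow_one,
    show -(3 * a - 1/2) = -(3 * a) + 1/2 by ring, Complex.cpow_add _ _ cC, cpow_half C hC,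
    Complex.real_smul]
  have s5 : ((Real.sqrt 5 : ℝ) : ℂ) ≠ 0 := by
    exact_mod_cast (by positivity : Real.sqrt 5 ≠ 0)
  have st : ((Real.sqrt t : ℝ) : ℂ) ≠ 0 := by
    exact_mod_cast (by positivity : Real.sqrt t ≠ 0)
  have sC : ((Real.sqrt C : ℝ) : ℂ) ≠ 0 := by
    exact_mod_cast (by positivity : Real.sqrt C ≠ 0)
  generalize (A : ℂ) ^ (3 * a) = x1
  generalize (B : ℂ) ^ (-(2 * a)) = x2
  generalize (C : ℂ) ^ (-(3 * a)) = x3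
  push_cast
  field_simp

lemma cov_s17 (a : ℂ) :
    Complex.betaIntegral a (1/2) = (Real.sqrt 5 : ℂ) *
      ∫ t : ℝ in 0..1, (((1 - (1/5) * (t:ℂ)) ^ (-(2 * a)) * (1 - (-4/5) * (t:ℂ)) ^ (-(3 * a - 1/2))) *
        ((t : ℂ) ^ ((1:ℂ)/2 - 1) * (1 - (t : ℂ)) ^ (3 * a - 1))) := by
  rw [← intervalIntegral.integral_const_mul, Complex.betaIntegral,
    intervalIntegral.integral_of_le zero_le_one, intervalIntegral.integral_of_le zero_le_one,
    integral_Ioc_eq_integral_Ioo, integral_Ioc_eq_integral_Ioo]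
  conv_lhs => rw [← Wf_image]
  rw [integral_image_eq_integral_abs_deriv_smul measurableSet_Ioo
    (fun t ht => (Wf_deriv t ⟨ht.1.le, ht.2.le⟩).hasDerivWithinAt)
    (Wf_anti.injOn.mono Set.Ioo_subset_Icc_self)]
  exact setIntegral_congr_fun measurableSet_Ioo fun t ht => cov_point a t ht

lemma main_pos (a : ℂ) (ha : 0 < a.re) :
    appellF1 (1/2) (2*a) (3*a - 1/2) (3*a + 1/2) (1/5) (-4/5) =
      (Real.sqrt (3/5) : ℂ) * Complex.Gamma (a + 1/6) * Complex.Gamma (a + 5/6) /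
        (Complex.Gamma (a + 1/3) * Complex.Gamma (a + 2/3)) := by
  have h3 : 0 < (3 * a).re := by simp [ha]
  have hh : 0 < ((1:ℂ)/2).re := by norm_num
  have h1 := appell_integral (1/2) (2*a) (3*a - 1/2) (3*a) (1/5) (-4/5) hh h3
    (by norm_num) (by norm_num)
  have h2 := cov_s17 a
  rw [← h1, Complex.betaIntegral_eq_Gamma_mul_div _ _ ha hh,
    Complex.betaIntegral_eq_Gamma_mul_div _ _ hh h3, add_comm (1/2) (3 * a)] at h2
  have h4 := Gamma_triple a ha
  have g : ∀ r : ℝ, 0 ≤ r → Complex.Gamma (a + r) ≠ 0 := fun r hr =>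
    Complex.Gamma_ne_zero_of_re_pos (by simp; linarith)
  have g0 := g 0 le_rfl
  have g1 := g (1/3) (by norm_num)
  have g2 := g (2/3) (by norm_num)
  have g3 := g (1/6) (by norm_num)
  have g4 := g (1/2) (by norm_num)
  have g5 := g (5/6) (by norm_num)
  push_cast at g0 g1 g2 g3 g4 g5
  rw [add_zero] at g0
  have g6 := Complex.Gamma_ne_zero_of_re_pos h3
  have g7 := Complex.Gamma_ne_zero_of_re_pos hh
  have g8 : Complex.Gamma (3 * a + 1/2) ≠ 0 :=
    Complex.Gamma_ne_zero_of_re_pos (by simp; linarith)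
  have s5 : ((Real.sqrt 5 : ℝ) : ℂ) ≠ 0 := by
    exact_mod_cast (by positivity : Real.sqrt 5 ≠ 0)
  rw [Real.sqrt_div (by norm_num)]
  push_cast
  exact aux_alg2 _ _ _ _ _ _ _ _ _ _ _ _ g0 g1 g2 g3 g4 g5 g6 g7 g8 s5 h2 h4

lemma cpoch_norm_le (b : ℂ) (B : ℝ) (h : ‖b‖ ≤ B) (n : ℕ) : ‖cpoch b n‖ ≤ ‖cpoch (B : ℂ) n‖ := by
  unfold cpoch
  rw [norm_prod, norm_prod]
  refine Finset.prod_le_prod (fun _ _ => norm_nonneg _) fun i _ => ?_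
  have hB : 0 ≤ B := (norm_nonneg _).trans h
  have : ‖(B : ℂ) + i‖ = B + i := by
    rw [← Complex.ofReal_natCast, ← Complex.ofReal_add, Complex.norm_real, Real.norm_of_nonneg (by positivity)]
  rw [this]
  calc ‖b + i‖ ≤ ‖b‖ + ‖(i : ℂ)‖ := norm_add_le _ _
    _ ≤ _ := by rw [Complex.norm_natCast]; linarith

lemma cpoch_half_le (a : ℂ) (ha : 0 ≤ a.re) (n : ℕ) : ‖cpoch (1/2) n‖ ≤ ‖cpoch (3 * a + 1/2) n‖ := by
  unfold cpoch
  rw [norm_prod, norm_prod]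
  refine Finset.prod_le_prod (fun _ _ => norm_nonneg _) fun i _ => ?_
  have : ‖(1/2 : ℂ) + i‖ = 1/2 + i := by
    rw [show (1/2 : ℂ) + i = ((1/2 + i : ℝ) : ℂ) by push_cast; ring, Complex.norm_real,
      Real.norm_of_nonneg (by positivity)]
  rw [this]
  refine le_trans ?_ (Complex.re_le_norm _)
  simp
  linarith

lemma cpoch_cont (n : ℕ) : Continuous (fun b => cpoch b n) := by
  unfold cpoch
  fun_prop

lemma appell_cont (R : ℝ) : ContinuousOn
    (fun a : ℂ => appellF1 (1/2) (2*a) (3*a - 1/2) (3*a + 1/2) (1/5) (-4/5))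
    {a : ℂ | 0 ≤ a.re ∧ ‖a‖ ≤ R} := by
  unfold appellF1
  refine continuousOn_tsum (u := fun p : ℕ × ℕ =>
    ‖cpoch ((3 * R + 1 : ℝ) : ℂ) p.1 / (p.1 ! : ℂ) * (1/5) ^ p.1‖ *
    ‖cpoch ((3 * R + 1 : ℝ) : ℂ) p.2 / (p.2 ! : ℂ) * (-4/5) ^ p.2‖) ?_ ?_ ?_
  · intro p
    have c1 := cpoch_cont p.1
    have c2 := cpoch_cont p.2
    have c3 := cpoch_cont (p.1 + p.2)
    have d1 : Continuous fun a : ℂ => cpoch (2 * a) p.1 := c1.comp (by fun_prop)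
    have d2 : Continuous fun a : ℂ => cpoch (3 * a - 1/2) p.2 := c2.comp (by fun_prop)
    have d3 : Continuous fun a : ℂ => cpoch (3 * a + 1/2) (p.1 + p.2) := c3.comp (by fun_prop)
    refine ContinuousOn.mul (ContinuousOn.mul (ContinuousOn.div ?_ ?_ ?_) continuousOn_const) continuousOn_const
    · exact ((continuous_const.mul d1).mul d2).continuousOn
    · exact ((d3.mul continuous_const).mul continuous_const).continuousOn
    · rintro a ⟨ha, -⟩
      have h1 : cpoch (3 * a + 1/2) (p.1 + p.2) ≠ 0 := cpoch_ne_zero _ (by simp; linarith) _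
      have h2 : (p.1 ! : ℂ) ≠ 0 := by exact_mod_cast p.1.factorial_ne_zero
      have h3 : (p.2 ! : ℂ) ≠ 0 := by exact_mod_cast p.2.factorial_ne_zero
      exact mul_ne_zero (mul_ne_zero h1 h2) h3
  · exact (summable_binom _ _ (by norm_num)).mul_of_nonneg (summable_binom _ _ (by norm_num))
      (fun _ => norm_nonneg _) (fun _ => norm_nonneg _)
  · rintro p a ⟨ha, haR⟩
    have h0 := cpoch_half_le a ha (p.1 + p.2)
    have hpos : 0 < ‖cpoch (3 * a + 1/2) (p.1 + p.2)‖ :=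
      norm_pos_iff.mpr (cpoch_ne_zero _ (by simp; linarith) _)
    have h1 := cpoch_norm_le (2 * a) (3 * R + 1) (by
      rw [norm_mul]; norm_num; linarith [norm_nonneg a]) p.1
    have h2 := cpoch_norm_le (3 * a - 1/2) (3 * R + 1) (by
      refine (norm_sub_le _ _).trans ?_
      rw [norm_mul]; norm_num; linarith [norm_nonneg a]) p.2
    calc _ = (‖cpoch (1/2) (p.1 + p.2)‖ / ‖cpoch (3 * a + 1/2) (p.1 + p.2)‖) *
          ((‖cpoch (2 * a) p.1‖ / ‖(p.1 ! : ℂ)‖ * ‖(1/5 : ℂ) ^ p.1‖) *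
          (‖cpoch (3 * a - 1/2) p.2‖ / ‖(p.2 ! : ℂ)‖ * ‖(-4/5 : ℂ) ^ p.2‖)) := by
          rw [norm_mul, norm_mul, norm_div, norm_mul, norm_mul, norm_mul, norm_mul]
          ring
      _ ≤ 1 * ((‖cpoch (2 * a) p.1‖ / ‖(p.1 ! : ℂ)‖ * ‖(1/5 : ℂ) ^ p.1‖) *
          (‖cpoch (3 * a - 1/2) p.2‖ / ‖(p.2 ! : ℂ)‖ * ‖(-4/5 : ℂ) ^ p.2‖)) := by
          gcongr
          exact (div_le_one hpos).mpr h0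
      _ ≤ _ := by
          rw [one_mul, norm_mul, norm_div, norm_mul, norm_div]
          gcongr

theorem stmt17 (a : ℂ) (ha : 0 ≤ a.re) :
    appellF1 (1/2) (2*a) (3*a - 1/2) (3*a + 1/2) (1/5) (-4/5) =
      (Real.sqrt (3/5) : ℂ) * Complex.Gamma (a + 1/6) * Complex.Gamma (a + 5/6) /
        (Complex.Gamma (a + 1/3) * Complex.Gamma (a + 2/3)) := by
  set S : Set ℂ := {z : ℂ | 0 ≤ z.re ∧ ‖z‖ ≤ ‖a‖ + 1} with hS
  have haS : a ∈ S := ⟨ha, by linarith⟩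
  have hL := appell_cont (‖a‖ + 1) a haS
  have gc : ∀ r : ℝ, 0 < r → ContinuousAt (fun z : ℂ => Complex.Gamma (z + r)) a := by
    intro r hr
    have : ContinuousAt Complex.Gamma (a + r) := by
      refine (Complex.differentiableAt_Gamma _ fun m h => ?_).continuousAt
      have := congrArg Complex.re h
      simp at this
      have : (0:ℝ) ≤ m := m.cast_nonneg
      linarith
    exact ContinuousAt.comp (f := fun z : ℂ => z + r) (g := Complex.Gamma) this (by fun_prop)
  have gn : ∀ r : ℝ, 0 < r → Complex.Gamma (a + r) ≠ 0 := fun r hr =>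
    Complex.Gamma_ne_zero_of_re_pos (by simp; linarith)
  have c1 := gc (1/3) (by norm_num)
  have c2 := gc (2/3) (by norm_num)
  have c3 := gc (1/6) (by norm_num)
  have c5 := gc (5/6) (by norm_num)
  have n1 := gn (1/3) (by norm_num)
  have n2 := gn (2/3) (by norm_num)
  push_cast at c1 c2 c3 c5 n1 n2
  have hR : ContinuousAt (fun a : ℂ => (Real.sqrt (3/5) : ℂ) * Complex.Gamma (a + 1/6) *
      Complex.Gamma (a + 5/6) / (Complex.Gamma (a + 1/3) * Complex.Gamma (a + 2/3))) a :=
    ((continuousAt_const.mul c3).mul c5).div (c1.mul c2) (mul_ne_zero n1 n2)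
  have hu0 : Tendsto (fun n : ℕ => a + ((1 / ((n : ℝ) + 1) : ℝ) : ℂ)) atTop (𝓝 a) := by
    have := (Complex.continuous_ofReal.tendsto 0).comp (tendsto_one_div_add_atTop_nhds_zero_nat (𝕜 := ℝ))
    simpa using this.const_add a
  have hpos : ∀ n : ℕ, 0 < 1 / ((n : ℝ) + 1) := fun n => by positivity
  have hle : ∀ n : ℕ, 1 / ((n : ℝ) + 1) ≤ 1 := fun n => by
    rw [div_le_one (by positivity)]; linarith [(n.cast_nonneg : (0:ℝ) ≤ n)]
  have hu : Tendsto (fun n : ℕ => a + ((1 / ((n : ℝ) + 1) : ℝ) : ℂ)) atTop (𝓝[S] a) := by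
    refine tendsto_nhdsWithin_iff.mpr ⟨hu0, Eventually.of_forall fun n => ⟨?_, ?_⟩⟩
    · rw [Complex.add_re, Complex.ofReal_re]; linarith [hpos n]
    · refine (norm_add_le _ _).trans ?_
      rw [Complex.norm_real, Real.norm_of_nonneg (hpos n).le]
      linarith [hle n]
  refine tendsto_nhds_unique (hL.tendsto.comp hu) ((hR.tendsto.comp hu0).congr fun n => ?_)
  refine (main_pos _ ?_).symm
  rw [Complex.add_re, Complex.ofReal_re]; linarith [hpos n]
end

section
/- Appell's hypergeometric series satisfies F₁(1/2; 2/3, 1/2; 11/6; 27/32, 5/6) = (2/3) · √2 · √3. -/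
open scoped Nat

open MeasureTheory Set ProbabilityTheory

noncomputable def rp (a : ℝ) (n : ℕ) : ℝ := ∏ i ∈ Finset.range n, (a + i)

lemma rp_pos {a : ℝ} (ha : 0 < a) (n : ℕ) : 0 < rp a n :=
  Finset.prod_pos (fun i _ => by positivity)

lemma rp_succ (a : ℝ) (n : ℕ) : rp a (n+1) = rp a n * (a + n) := by
  simp [rp, Finset.prod_range_succ]

lemma lint_beta {a b : ℝ} (ha : 0 < a) (hb : 0 < b) :
    ∫⁻ t in Ioo (0:ℝ) 1, ENNReal.ofReal (t^(a-1) * (1-t)^(b-1)) = ENNReal.ofReal (beta a b) := by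
  have h := lintegral_betaPDF_eq_one ha hb
  rw [lintegral_betaPDF] at h
  have hp := beta_pos ha hb
  have h2 : ∫⁻ (x : ℝ) in Ioo 0 1, ENNReal.ofReal (1 / beta a b * x ^ (a - 1) * (1 - x) ^ (b - 1))
      = ENNReal.ofReal (1 / beta a b) *
        ∫⁻ t in Ioo (0:ℝ) 1, ENNReal.ofReal (t^(a-1) * (1-t)^(b-1)) := by
    rw [← lintegral_const_mul' _ _ ENNReal.ofReal_ne_top]
    congr 1
    ext t
    rw [← ENNReal.ofReal_mul (by positivity), mul_assoc]
  rw [h2] at h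
  calc _ = ENNReal.ofReal (beta a b) * (ENNReal.ofReal (1 / beta a b) *
        ∫⁻ t in Ioo (0:ℝ) 1, ENNReal.ofReal (t^(a-1) * (1-t)^(b-1))) := by
        rw [← mul_assoc, ← ENNReal.ofReal_mul hp.le, mul_one_div_cancel hp.ne']
        simp
    _ = _ := by rw [h, mul_one]

lemma beta_shift {a b : ℝ} (ha : 0 < a) (hb : 0 < b) (k : ℕ) :
    beta (a + k) b = beta a b * (rp a k / rp (a+b) k) := by
  induction k with
  | zero => simp [rp]
  | succ k ih =>
    have h1 : beta (a + (k+1:ℕ)) b = beta (a+k) b * ((a + k) / (a + b + k)) := by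
      unfold beta
      have e1 : a + ((k+1:ℕ):ℝ) = (a + k) + 1 := by push_cast; ring
      have e2 : (a + k) + 1 + b = (a + k + b) + 1 := by ring
      rw [e1, e2, Real.Gamma_add_one (by positivity), Real.Gamma_add_one (by positivity)]
      have e3 := (Real.Gamma_pos_of_pos (show 0 < a + k + b by positivity)).ne'
      have e4 : a + k + b ≠ 0 := by positivity
      rw [show a + b + k = a + k + b by ring]
      field_simp
    have := (rp_pos (show 0 < a + b by positivity) k).ne'
    have : a + b + k ≠ 0 := by positivity
    rw [h1, ih, rp_succ, rp_succ]
    field_simp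

lemma beta_shift_right : beta (1/2) (4/3) = (2/5) * beta (1/2) (1/3) := by
  unfold beta
  rw [show (4/3:ℝ) = 1/3 + 1 by norm_num, show (1/2 + (1/3+1) : ℝ) = (1/2+1/3) + 1 by norm_num,
    Real.Gamma_add_one (by norm_num), Real.Gamma_add_one (by norm_num)]
  have := (Real.Gamma_pos_of_pos (show (0:ℝ) < 1/2 + 1/3 by norm_num)).ne'
  field_simp
  norm_num

lemma choose_rp (a : ℝ) (n : ℕ) : Ring.choose (a + n - 1) n = rp a n / n ! := by
  rw [← Ring.multichoose_eq, eq_div_iff (by positivity), mul_comm, ← nsmul_eq_mul,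
    Ring.factorial_nsmul_multichoose_eq_ascPochhammer]
  induction n with
  | zero => simp [rp]
  | succ n ih =>
    rw [ascPochhammer_succ_right, Polynomial.smeval_mul, ih, rp_succ]
    simp [Polynomial.smeval_add, Polynomial.smeval_X, Polynomial.smeval_natCast]

lemma binom (a : ℝ) {z : ℝ} (hz : 0 ≤ z) (hz1 : z < 1) :
    HasSum (fun n => rp a n / n ! * z^n) ((1-z)^(-a)) := by
  have h := (Real.one_div_one_sub_rpow_hasFPowerSeriesOnBall_zero a).hasSum (y := z) (by
    simp [abs_of_nonneg hz, enorm_eq_nnnorm]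
    rw [← NNReal.coe_lt_coe]
    simpa [abs_of_nonneg hz])
  rw [Real.rpow_neg (by linarith), ← one_div]
  have e : (fun n => rp a n / n ! * z^n) = fun n =>
      (FormalMultilinearSeries.ofScalars ℝ (fun n => Ring.choose (a + (n:ℝ) - 1) n) n)
        fun _ => z := by
    funext n
    rw [FormalMultilinearSeries.ofScalars_apply_eq, choose_rp, smul_eq_mul]
  rw [e]
  rwa [zero_add] at h

lemma binom_enn {a : ℝ} (ha : 0 < a) {z : ℝ} (hz : 0 ≤ z) (hz1 : z < 1) :
    ∑' n, ENNReal.ofReal (rp a n / n ! * z^n) = ENNReal.ofReal ((1-z)^(-a)) := by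
  have h := binom a hz hz1
  rw [← h.tsum_eq, ENNReal.ofReal_tsum_of_nonneg _ h.summable]
  intro n
  have := rp_pos ha n
  positivity

noncomputable def TT (p : ℕ × ℕ) : ℝ :=
  rp (1/2) (p.1 + p.2) * rp (2/3) p.1 * rp (1/2) p.2 /
      (rp (11/6) (p.1 + p.2) * (p.1 ! : ℝ) * (p.2 ! : ℝ)) * (27/32) ^ p.1 * (5/6) ^ p.2

lemma TT_nonneg (p : ℕ × ℕ) : 0 ≤ TT p := by
  have h1 := rp_pos (show (0:ℝ) < 1/2 by norm_num)
  have h2 := rp_pos (show (0:ℝ) < 2/3 by norm_num)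
  have h3 := rp_pos (show (0:ℝ) < 11/6 by norm_num)
  have := h1 (p.1+p.2)
  have := h1 p.2
  have := h2 p.1
  have := h3 (p.1+p.2)
  unfold TT
  positivity

noncomputable def gg (t : ℝ) : ℝ := t^((1/2:ℝ)-1) * (1-t)^((4/3:ℝ)-1) *
  ((1-27/32*t)^(-(2/3):ℝ) * (1-5/6*t)^(-(1/2):ℝ))

lemma euler : ENNReal.ofReal (beta (1/2) (4/3)) * ∑' p, ENNReal.ofReal (TT p) =
    ∫⁻ t in Ioo (0:ℝ) 1, ENNReal.ofReal (gg t) := by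
  have hb := beta_pos (show (0:ℝ) < 1/2 by norm_num) (show (0:ℝ) < 4/3 by norm_num)
  rw [← ENNReal.tsum_mul_left]
  have step : ∀ p : ℕ × ℕ, ENNReal.ofReal (beta (1/2) (4/3)) * ENNReal.ofReal (TT p) =
      ∫⁻ t in Ioo (0:ℝ) 1, ENNReal.ofReal (t^((1/2:ℝ)-1) * (1-t)^((4/3:ℝ)-1)) *
        (ENNReal.ofReal (rp (2/3) p.1 / p.1 ! * (27/32*t)^p.1) *
         ENNReal.ofReal (rp (1/2) p.2 / p.2 ! * (5/6*t)^p.2)) := by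
    intro p
    have h1 := rp_pos (show (0:ℝ) < 1/2 by norm_num) p.2
    have h2 := rp_pos (show (0:ℝ) < 2/3 by norm_num) p.1
    have h3 := rp_pos (show (0:ℝ) < 11/6 by norm_num) (p.1+p.2)
    have hL := lint_beta (a := 1/2 + (p.1+p.2:ℕ)) (b := 4/3) (by positivity) (by norm_num)
    have : ∀ t ∈ Ioo (0:ℝ) 1, ENNReal.ofReal (t^((1/2:ℝ)-1) * (1-t)^((4/3:ℝ)-1)) *
        (ENNReal.ofReal (rp (2/3) p.1 / p.1 ! * (27/32*t)^p.1) *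
         ENNReal.ofReal (rp (1/2) p.2 / p.2 ! * (5/6*t)^p.2)) =
        ENNReal.ofReal (rp (2/3) p.1 / p.1 ! * (27/32)^p.1 * (rp (1/2) p.2 / p.2 ! * (5/6)^p.2)) *
        ENNReal.ofReal (t^((1/2 + (p.1+p.2:ℕ):ℝ)-1) * (1-t)^((4/3:ℝ)-1)) := by
      rintro t ⟨ht0, ht1⟩
      have : 0 < 1 - t := by linarith
      rw [← ENNReal.ofReal_mul (by positivity), ← ENNReal.ofReal_mul (by positivity),
        ← ENNReal.ofReal_mul (by positivity)]
      congr 1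
      rw [show (1/2 + (p.1+p.2:ℕ):ℝ)-1 = (1/2-1) + (p.1+p.2:ℕ) by ring,
        Real.rpow_add ht0, Real.rpow_natCast]
      ring
    rw [setLIntegral_congr_fun measurableSet_Ioo this,
      lintegral_const_mul' _ _ ENNReal.ofReal_ne_top, hL,
      beta_shift (by norm_num) (by norm_num), ← ENNReal.ofReal_mul hb.le,
      ← ENNReal.ofReal_mul (by positivity)]
    congr 1
    rw [show (1/2 + 4/3 : ℝ) = 11/6 by norm_num]
    unfold TT
    field_simp
  simp_rw [step]
  rw [← lintegral_tsum]
  · refine setLIntegral_congr_fun measurableSet_Ioo ?_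
    rintro t ⟨ht0, ht1⟩
    have : 0 < 1 - t := by linarith
    have : 0 < 1 - 27/32*t := by linarith
    have : 0 < 1 - 5/6*t := by linarith
    simp only
    rw [ENNReal.tsum_mul_left, ENNReal.tsum_prod']
    simp only [ENNReal.tsum_mul_left]
    rw [ENNReal.tsum_mul_right]
    rw [binom_enn (by norm_num) (by positivity) (by linarith),
      binom_enn (by norm_num) (by positivity) (by linarith),
      ← ENNReal.ofReal_mul (by positivity), ← ENNReal.ofReal_mul (by positivity), gg]
  · intro p
    apply Measurable.aemeasurable
    fun_prop

noncomputable def phi (t : ℝ) : ℝ := 75/32 * t * (1 - 14/9*t + 3/5*t^2)^2 / (1-5/6*t)^3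

noncomputable def phi' (t : ℝ) : ℝ := 75/32 * (1-t)^3 * (1 - 14/9*t + 3/5*t^2) / (1-5/6*t)^4

lemma phi_one_sub {t : ℝ} (ht : t ≤ 1) : 1 - phi t = (1-t)^4 * (1-27/32*t) / (1-5/6*t)^3 := by
  have : 1 - 5/6*t ≠ 0 := by linarith
  unfold phi
  rw [eq_div_iff (by positivity), sub_mul, div_mul_cancel₀ _ (by positivity)]
  ring

lemma phi_deriv {t : ℝ} (ht : t ≤ 1) : HasDerivAt phi (phi' t) t := by
  have h0 : 1 - 5/6*t ≠ 0 := by linarith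
  have hid := hasDerivAt_id t
  have hc : HasDerivAt (fun t : ℝ => 1 - 14/9*t + 3/5*t^2) (-(14/9) + 6/5*t) t := by
    have := ((hid.const_mul (14/9)).const_sub 1).add ((hid.pow 2).const_mul (3/5))
    convert! this using 1
    simp; ring
  have hd : HasDerivAt (fun t : ℝ => 1 - 5/6*t) (-(5/6)) t := by
    have := (hid.const_mul (5/6)).const_sub 1
    convert! this using 1
    simp
  have := ((hid.const_mul (75/32)).mul (hc.pow 2)).div (hd.pow 3) (pow_ne_zero 3 h0)
  convert! this using 1
  unfold phi'
  rw [div_eq_div_iff (by positivity) (by simp; positivity)]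
  simp
  ring

lemma c_pos {t : ℝ} (ht0 : 0 ≤ t) (ht : t ≤ 1) : 0 < 1 - 14/9*t + 3/5*t^2 := by
  nlinarith [mul_nonneg (sub_nonneg.2 ht) (sub_nonneg.2 ht)]

lemma phi_cont : ContinuousOn phi (Icc 0 1) :=
  fun _ ht => (phi_deriv ht.2).continuousAt.continuousWithinAt

lemma phi_mono : StrictMonoOn phi (Icc 0 1) := by
  apply strictMonoOn_of_deriv_pos (convex_Icc _ _) phi_cont
  intro t ht
  rw [interior_Icc] at ht
  rw [(phi_deriv ht.2.le).deriv]
  have := c_pos ht.1.le ht.2.le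
  have : 0 < 1 - t := by linarith [ht.2]
  have : 0 < 1 - 5/6*t := by linarith [ht.2]
  unfold phi'
  positivity

lemma phi_image : phi '' Ioo 0 1 = Ioo 0 1 := by
  have p0 : phi 0 = 0 := by norm_num [phi]
  have p1 : phi 1 = 1 := by norm_num [phi]
  apply Subset.antisymm
  · rintro _ ⟨t, ht, rfl⟩
    constructor
    · rw [← p0]; exact phi_mono (by simp) ⟨ht.1.le, ht.2.le⟩ ht.1
    · rw [← p1]; exact phi_mono ⟨ht.1.le, ht.2.le⟩ (by simp) ht.2
  · have := intermediate_value_Ioo zero_le_one phi_cont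
    rwa [p0, p1] at this

lemma key {t : ℝ} (ht0 : 0 < t) (ht1 : t < 1) :
    phi' t * ((phi t)^((1/2:ℝ)-1) * (1 - phi t)^((1/3:ℝ)-1)) = Real.sqrt (75/32) * gg t := by
  have hA : 0 < 1 - t := by linarith
  have hX : 0 < 1 - 27/32*t := by linarith
  have hY : 0 < 1 - 5/6*t := by linarith
  have hC := c_pos ht0.le ht1.le
  rw [phi_one_sub ht1.le]
  unfold phi phi' gg
  rw [Real.sqrt_eq_rpow]
  generalize 1 - 14/9*t + 3/5*t^2 = c at *
  generalize 1 - 27/32*t = x at *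
  generalize 1 - 5/6*t = y at *
  generalize 1 - t = u at *
  have hK : (0:ℝ) < 75/32 := by norm_num
  generalize (75/32:ℝ) = K at *
  apply Real.log_injOn_pos (by simp only [mem_Ioi]; positivity) (by simp only [mem_Ioi]; positivity)
  have lg : ∀ {z : ℝ} (r : ℝ), 0 < z → Real.log (z^r) = r * Real.log z := fun r hz =>
    Real.log_rpow hz r
  have l1 : Real.log (K * t * c^2 / y^3) =
      Real.log K + Real.log t + 2 * Real.log c - 3 * Real.log y := by
    rw [Real.log_div (by positivity) (by positivity), Real.log_mul (by positivity) (by positivity),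
      Real.log_mul (by positivity) (by positivity), Real.log_pow, Real.log_pow]
    norm_num
  have l2 : Real.log (u^4 * x / y^3) = 4 * Real.log u + Real.log x - 3 * Real.log y := by
    rw [Real.log_div (by positivity) (by positivity), Real.log_mul (by positivity) (by positivity),
      Real.log_pow, Real.log_pow]
    norm_num
  have l3 : Real.log (K * u^3 * c / y^4) =
      Real.log K + 3 * Real.log u + Real.log c - 4 * Real.log y := by
    rw [Real.log_div (by positivity) (by positivity), Real.log_mul (by positivity) (by positivity),
      Real.log_mul (by positivity) (by positivity), Real.log_pow, Real.log_pow]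
    norm_num
  rw [Real.log_mul (by positivity) (by positivity), Real.log_mul (by positivity) (by positivity),
    Real.log_mul (by positivity) (by positivity), Real.log_mul (by positivity) (by positivity),
    Real.log_mul (by positivity) (by positivity), Real.log_mul (by positivity) (by positivity),
    lg _ (by positivity), lg _ (by positivity), lg _ (by positivity), lg _ (by positivity),
    lg _ (by positivity), lg _ (by positivity), lg _ (by positivity), l1, l2, l3]
  ring

lemma subst : ENNReal.ofReal (beta (1/2) (1/3)) = ENNReal.ofReal (Real.sqrt (75/32)) *
    ∫⁻ t in Ioo (0:ℝ) 1, ENNReal.ofReal (gg t) := by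
  have h := lintegral_image_eq_lintegral_abs_deriv_mul (s := Ioo (0:ℝ) 1) (f := phi) (f' := phi')
    measurableSet_Ioo (fun t ht => (phi_deriv ht.2.le).hasDerivWithinAt)
    (phi_mono.injOn.mono Ioo_subset_Icc_self)
    (fun s => ENNReal.ofReal (s^((1/2:ℝ)-1) * (1-s)^((1/3:ℝ)-1)))
  rw [phi_image, lint_beta (by norm_num) (by norm_num)] at h
  rw [h, ← lintegral_const_mul' _ _ ENNReal.ofReal_ne_top]
  refine setLIntegral_congr_fun measurableSet_Ioo ?_
  rintro t ⟨ht0, ht1⟩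
  have hp : 0 ≤ phi' t := by
    have := c_pos ht0.le ht1.le
    have : 0 < 1 - t := by linarith
    unfold phi'
    positivity
  simp only
  rw [abs_of_nonneg hp, ← ENNReal.ofReal_mul hp, ← ENNReal.ofReal_mul (by positivity), key ht0 ht1]

lemma enn_sum : ∑' p, ENNReal.ofReal (TT p) = ENNReal.ofReal (2/3 * √2 * √3) := by
  have h := subst
  rw [← euler, beta_shift_right] at h
  have hb := beta_pos (show (0:ℝ) < 1/2 by norm_num) (show (0:ℝ) < 1/3 by norm_num)
  generalize beta (1/2) (1/3) = b at *
  rw [← mul_assoc, ← ENNReal.ofReal_mul (by positivity)] at h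
  have hs : √(75/32) = 5/8 * √2 * √3 := by
    rw [Real.sqrt_eq_iff_mul_self_eq (by norm_num) (by positivity)]
    have h2 := Real.mul_self_sqrt (show (0:ℝ) ≤ 2 by norm_num)
    have h3 := Real.mul_self_sqrt (show (0:ℝ) ≤ 3 by norm_num)
    symm
    calc _ = 25/64 * (√2 * √2) * (√3 * √3) := by ring
      _ = _ := by rw [h2, h3]; norm_num
  have hpos : 0 < √(75/32) * (2/5 * b) := by positivity
  have h4 : b = √(75/32) * (2/5 * b) * (2/3 * √2 * √3) := by
    rw [hs]
    have h2 := Real.mul_self_sqrt (show (0:ℝ) ≤ 2 by norm_num)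
    have h3 := Real.mul_self_sqrt (show (0:ℝ) ≤ 3 by norm_num)
    calc b = 1/6 * 2 * 3 * b := by ring
      _ = 1/6 * (√2 * √2) * (√3 * √3) * b := by rw [h2, h3]
      _ = _ := by ring
  nth_rewrite 1 [h4] at h
  rw [ENNReal.ofReal_mul hpos.le] at h
  exact ((ENNReal.mul_right_inj (by simpa using hpos) ENNReal.ofReal_ne_top).1 h).symm

lemma real_sum : ∑' p, TT p = 2/3 * √2 * √3 := by
  have h := congrArg ENNReal.toReal enn_sum
  rw [ENNReal.tsum_toReal_eq (fun _ => ENNReal.ofReal_ne_top),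
    ENNReal.toReal_ofReal (by positivity)] at h
  rw [← h]
  exact tsum_congr (fun p => (ENNReal.toReal_ofReal (TT_nonneg p)).symm)

theorem stmt18 :
    appellF1 (1/2) (2/3) (1/2) (11/6) (27/32) (5/6) =
      (2/3) * (Real.sqrt 2 : ℂ) * (Real.sqrt 3 : ℂ) := by
  have h := congrArg (fun r : ℝ => (r : ℂ)) real_sum
  simp only [Complex.ofReal_tsum] at h
  unfold appellF1
  push_cast at h
  rw [← h]
  refine tsum_congr (fun p => ?_)
  simp [TT, rp, cpoch]
end
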